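/- arXiv:1911.04047 — 4 statements merged into one kernel-verified Lean document; each statement's English description precedes it below -/
import Mathlib

section
/- Let E and F be real inner product spaces and let ℓ : E → F → ℝ be a loss function such that: (i) for every θ ∈ F the map x ↦ ℓ(x, θ) is differentiable and L_x-smooth in x; (ii) for every x ∈ E the map θ ↦ ∇_x ℓ(x, θ) (the gradient with respect to the first argument) is L_θ-Lipschitz in θ; and (iii) ∇_x ℓ(x, 0) = 0 for every x. If λ_w > L_x, then for every x ∈ E, every θ ∈ F, and every x̂ ∈ E, one has ℓ(x̂, θ) − (λ_w/2)‖x̂ − x‖² ≤ ℓ(x, θ) + (γ/2)‖θ‖², where γ = L_θ²/(λ_w − L_x). (Theorem 1: regularization bounds the Wasserstein-penalized worst-case loss.) -/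
open RealInnerProductSpace

/-- **Theorem 1** (regularization bounds the Wasserstein-penalized worst-case loss).
`ℓ x θ` is the loss, `g x θ` is the gradient of `x' ↦ ℓ x' θ` at `x`. -/
theorem regularization_bounds_worst_case_loss
    {E F : Type*} [NormedAddCommGroup E] [InnerProductSpace ℝ E] [CompleteSpace E]
    [NormedAddCommGroup F] [InnerProductSpace ℝ F]
    (ℓ : E → F → ℝ) (g : E → F → E) (Lx Lθ lw : ℝ)
    (hLx : 0 ≤ Lx) (hLθ : 0 ≤ Lθ) (hlw : lw > Lx)
    (hgrad : ∀ (x : E) (θ : F), HasGradientAt (fun x' => ℓ x' θ) (g x θ) x)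
    (hsmooth : ∀ (θ : F) (x' x'' : E),
      ℓ x'' θ ≤ ℓ x' θ + ⟪g x' θ, x'' - x'⟫ + Lx / 2 * ‖x'' - x'‖ ^ 2)
    (hlip : ∀ (x : E) (θ₁ θ₂ : F), ‖g x θ₁ - g x θ₂‖ ≤ Lθ * ‖θ₁ - θ₂‖)
    (hzero : ∀ x : E, g x 0 = 0) :
    ∀ (x : E) (θ : F) (xhat : E),
      ℓ xhat θ - lw / 2 * ‖xhat - x‖ ^ 2 ≤ ℓ x θ + (Lθ ^ 2 / (lw - Lx)) / 2 * ‖θ‖ ^ 2 := by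
  intro x θ xhat
  have hc : 0 < lw - Lx := sub_pos.mpr hlw
  have hnorm : ‖g x θ‖ ≤ Lθ * ‖θ‖ := by
    simpa [hzero] using hlip x θ 0
  have hinner : ⟪g x θ, xhat - x⟫ ≤ Lθ * ‖θ‖ * ‖xhat - x‖ :=
    (real_inner_le_norm _ _).trans (mul_le_mul_of_nonneg_right hnorm (norm_nonneg _))
  have hyoung : Lθ * ‖θ‖ * ‖xhat - x‖ ≤
      (lw - Lx) / 2 * ‖xhat - x‖ ^ 2 + (Lθ ^ 2 / (lw - Lx)) / 2 * ‖θ‖ ^ 2 := by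
    have hsq : 0 ≤ ((lw - Lx) * ‖xhat - x‖ - Lθ * ‖θ‖) ^ 2 / (2 * (lw - Lx)) := by positivity
    have heq : ((lw - Lx) * ‖xhat - x‖ - Lθ * ‖θ‖) ^ 2 / (2 * (lw - Lx)) =
        (lw - Lx) / 2 * ‖xhat - x‖ ^ 2 + (Lθ ^ 2 / (lw - Lx)) / 2 * ‖θ‖ ^ 2
          - Lθ * ‖θ‖ * ‖xhat - x‖ := by
      have hne := hc.ne'
      field_simp
      ring
    linarith
  linarith [hsmooth θ x xhat]
end

section
/- Let E be a real inner product space and let f : E → ℝ be differentiable and L-smooth. If λ > L, then for every x ∈ E and every x̂ ∈ E, one has f(x̂) − (λ/2)‖x̂ − x‖² ≤ f(x) + ‖∇f(x)‖²/(2(λ − L)). (Key step in the proof of Theorem 1: the penalized worst-case value over the data space is bounded by the loss at x plus a squared-gradient term.) -/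
open RealInnerProductSpace

/-- Key step in the proof of Theorem 1: for a differentiable `L`-smooth `f` and `λ > L`,
the penalized worst-case value is bounded by the loss plus a squared-gradient term.
`f'` denotes the gradient of `f`. -/
theorem smooth_penalized_worst_case_bound
    {E : Type*} [NormedAddCommGroup E] [InnerProductSpace ℝ E] [CompleteSpace E]
    (f : E → ℝ) (f' : E → E) (L lam : ℝ)
    (hL : 0 ≤ L) (hlam : lam > L)
    (hgrad : ∀ x : E, HasGradientAt f (f' x) x)
    (hsmooth : ∀ x' x'' : E, f x'' ≤ f x' + ⟪f' x', x'' - x'⟫ + L / 2 * ‖x'' - x'‖ ^ 2) :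
    ∀ x xhat : E, f xhat - lam / 2 * ‖xhat - x‖ ^ 2 ≤ f x + ‖f' x‖ ^ 2 / (2 * (lam - L)) := by
  intro x xhat
  have hpos : 0 < lam - L := sub_pos.mpr hlam
  have hyoung : ‖f' x‖ * ‖xhat - x‖ - (lam - L) / 2 * ‖xhat - x‖ ^ 2
      ≤ ‖f' x‖ ^ 2 / (2 * (lam - L)) := by
    rw [le_div_iff₀ (by positivity)]
    nlinarith [sq_nonneg (‖f' x‖ - (lam - L) * ‖xhat - x‖)]
  linarith [hsmooth x xhat, real_inner_le_norm (f' x) (xhat - x)]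
end

section
/- Let K ∈ ℕ, let Δ ⊆ ℝ^K be the standard probability simplex, and let λ > 0, μ > 0. For t = 1, …, T let f_t : ℝ^K → ℝ be differentiable and λ-strongly concave, let q_1 ∈ Δ, let g_t = ∇f_t(q_t) satisfy ‖g_t‖₂ ≤ μ, and let q_{t+1} be the Euclidean projection of q_t + η_t g_t onto Δ with learning rate η_t = 1/(λ t). Then for every q* ∈ Δ, Σ_{t=1}^T (f_t(q*) − f_t(q_t)) ≤ (μ²/(2λ)) (log T + 1). (Regret bound for projected gradient ascent with the conventional learning rate 1/(λt), a sub-result in the proof of Theorem 3.) -/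
open RealInnerProductSpace

/-- The standard probability simplex in `ℝ^K` (with the Euclidean norm). -/
def probSimplex (K : ℕ) : Set (EuclideanSpace ℝ (Fin K)) :=
  {p | (∑ k, p k) = 1 ∧ ∀ k, 0 ≤ p k}

theorem convex_probSimplex (K : ℕ) : Convex ℝ (probSimplex K) := by
  rintro x ⟨hx, hx0⟩ y ⟨hy, hy0⟩ a b ha hb hab
  refine ⟨?_, fun k => ?_⟩
  · simp [Finset.sum_add_distrib, ← Finset.mul_sum, hx, hy, hab]
  · simpa using add_nonneg (mul_nonneg ha (hx0 k)) (mul_nonneg hb (hy0 k))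

/-- A nearest point of a convex set to `u` is no farther from points of the set than `u` is. -/
theorem norm_sub_sq_le_of_nearest {E : Type*} [NormedAddCommGroup E] [InnerProductSpace ℝ E]
    {s : Set E} (hs : Convex ℝ s) {u v w : E} (hv : v ∈ s) (hw : w ∈ s)
    (hmin : ∀ p ∈ s, ‖v - u‖ ≤ ‖p - u‖) : ‖v - w‖ ^ 2 ≤ ‖u - w‖ ^ 2 := by
  have : Nonempty s := ⟨⟨v, hv⟩⟩
  have heq : ‖u - v‖ = ⨅ p : s, ‖u - p‖ := by
    refine le_antisymm (le_ciInf fun p => ?_)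
      (ciInf_le (f := fun p : s => ‖u - p‖) ⟨0, ?_⟩ ⟨v, hv⟩)
    · simpa only [norm_sub_rev] using hmin p p.2
    · rintro _ ⟨p, rfl⟩
      exact norm_nonneg _
  have hle := (norm_eq_iInf_iff_real_inner_le_zero hs hv).1 heq w hw
  have hsub := norm_sub_sq_real (u - v) (w - v)
  rw [sub_sub_sub_cancel_right] at hsub
  rw [norm_sub_rev v w]
  nlinarith [sq_nonneg ‖u - v‖]

/-- One step of projected gradient ascent with step size `1 / c`. -/
theorem inner_le_of_projected_step {E : Type*} [NormedAddCommGroup E] [InnerProductSpace ℝ E]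
    {s : Set E} (hs : Convex ℝ s) {c mu : ℝ} (hc : 0 < c) {x g v w : E}
    (hg : ‖g‖ ≤ mu) (hv : v ∈ s) (hw : w ∈ s)
    (hmin : ∀ p ∈ s, ‖v - (x + (1 / c) • g)‖ ≤ ‖p - (x + (1 / c) • g)‖) :
    ⟪g, w - x⟫ ≤ c / 2 * ‖w - x‖ ^ 2 - c / 2 * ‖w - v‖ ^ 2 + mu ^ 2 / (2 * c) := by
  have hstep := norm_sub_sq_le_of_nearest hs hv hw hmin
  have hexp : ‖x + (1 / c) • g - w‖ ^ 2
      = ‖w - x‖ ^ 2 - 2 * (1 / c * ⟪g, w - x⟫) + (1 / c) ^ 2 * ‖g‖ ^ 2 := by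
    rw [norm_sub_rev, ← sub_sub, norm_sub_sq_real, inner_smul_right, real_inner_comm, norm_smul,
      mul_pow, Real.norm_eq_abs, sq_abs]
  rw [hexp, norm_sub_rev v w] at hstep
  have hg2 : ‖g‖ ^ 2 ≤ mu ^ 2 := by gcongr
  have hmul := mul_le_mul_of_nonneg_left hstep (half_pos hc).le
  have hsimp : c / 2 * (‖w - x‖ ^ 2 - 2 * (1 / c * ⟪g, w - x⟫) + (1 / c) ^ 2 * ‖g‖ ^ 2)
      = c / 2 * ‖w - x‖ ^ 2 - ⟪g, w - x⟫ + ‖g‖ ^ 2 / (2 * c) := by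
    field_simp
  have hdiv : ‖g‖ ^ 2 / (2 * c) ≤ mu ^ 2 / (2 * c) := by gcongr
  linarith

/-- Regret bound for projected gradient ascent with the conventional learning rate
`η_t = 1/(λ t)`, a sub-result in the proof of Theorem 3.  `f t` is differentiable
`λ`-strongly concave with gradient field `G t`, the gradients at the iterates are
bounded by `μ`, `q 1 ∈ Δ`, and `q (t+1)` is the Euclidean projection of
`q t + η_t • G t (q t)` onto the simplex. -/
theorem projected_gradient_ascent_regret
    (K T : ℕ) (lam mu : ℝ) (hlam : 0 < lam) (hmu : 0 < mu)
    (f : ℕ → EuclideanSpace ℝ (Fin K) → ℝ)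
    (G : ℕ → EuclideanSpace ℝ (Fin K) → EuclideanSpace ℝ (Fin K))
    (q : ℕ → EuclideanSpace ℝ (Fin K))
    (hgrad : ∀ t x, HasGradientAt (f t) (G t x) x)
    (hconc : ∀ t x y, f t y ≤ f t x + ⟪G t x, y - x⟫ - lam / 2 * ‖y - x‖ ^ 2)
    (hq1 : q 1 ∈ probSimplex K)
    (hgbound : ∀ t, 1 ≤ t → t ≤ T → ‖G t (q t)‖ ≤ mu)
    (hproj : ∀ t, 1 ≤ t → t ≤ T →
      q (t + 1) ∈ probSimplex K ∧
      ∀ p ∈ probSimplex K,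
        ‖q (t + 1) - (q t + (1 / (lam * t)) • G t (q t))‖
          ≤ ‖p - (q t + (1 / (lam * t)) • G t (q t))‖) :
    ∀ qstar ∈ probSimplex K,
      ∑ t ∈ Finset.Icc 1 T, (f t qstar - f t (q t))
        ≤ mu ^ 2 / (2 * lam) * (Real.log T + 1) := by
  intro qstar hqstar
  have key : ∀ n ≤ T, ∑ t ∈ Finset.Icc 1 n, (f t qstar - f t (q t))
      ≤ mu ^ 2 / (2 * lam) * (harmonic n : ℝ) - lam * n / 2 * ‖qstar - q (n + 1)‖ ^ 2 := by
    intro n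
    induction n with
    | zero => simp
    | succ n ih =>
      intro hn
      have h1 : 1 ≤ n + 1 := Nat.le_add_left 1 n
      have hpos : (0 : ℝ) < (n + 1 : ℕ) := by positivity
      obtain ⟨hmem, hmin⟩ := hproj (n + 1) h1 hn
      have hstep := inner_le_of_projected_step (convex_probSimplex K) (mul_pos hlam hpos)
        (hgbound (n + 1) h1 hn) hmem hqstar hmin
      have hcon := hconc (n + 1) (q (n + 1)) qstar
      have hsum := ih (Nat.le_of_succ_le hn)
      rw [Finset.sum_Icc_succ_top h1, harmonic_succ]
      have hmu : mu ^ 2 / (2 * (lam * (n + 1 : ℕ)))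
          = mu ^ 2 / (2 * lam) * ((n + 1 : ℕ) : ℝ)⁻¹ := by
        field_simp
      rw [hmu] at hstep
      push_cast at hstep ⊢
      linarith
  calc ∑ t ∈ Finset.Icc 1 T, (f t qstar - f t (q t))
      ≤ mu ^ 2 / (2 * lam) * (harmonic T : ℝ) - lam * T / 2 * ‖qstar - q (T + 1)‖ ^ 2 :=
        key T le_rfl
    _ ≤ mu ^ 2 / (2 * lam) * (harmonic T : ℝ) := sub_le_self _ (by positivity)
    _ ≤ mu ^ 2 / (2 * lam) * (Real.log T + 1) := by
        rw [add_comm]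
        gcongr
        exact harmonic_le_one_add_log T
end

section
/- Let K ∈ ℕ, let Δ ⊆ ℝ^K be the standard probability simplex, let λ > 0, μ > 0, and let 2 ≤ s ≤ T be integers such that c := (μ/λ)√(log s / (2s)) > 1. For t = 1, …, T let f_t : ℝ^K → ℝ be differentiable and λ-strongly concave, let q_1 ∈ Δ, let g_t = ∇f_t(q_t) satisfy ‖g_t‖₂ ≤ μ, and let q_{t+1} be the Euclidean projection of q_t + η_t g_t onto Δ, where η_t = 1/(c λ t) for t ≤ s and η_t = 1/(λ t) for t > s. Then for every q* ∈ Δ, (1/T) Σ_{t=1}^T (f_t(q*) − f_t(q_t)) ≤ (1/T) ( (μ²/(2λ)) (log T + 1) − β ), where β = ( μ √(log s / (2λ)) − √(s λ) )². (Theorem 3, deterministic form: O(log(T)/T) convergence of the adversarial distribution with variance-reducing adaptive learning rates.) -/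
open RealInnerProductSpace

theorem norm_sub_sq_le_two_of_mem_probSimplex {K : ℕ} {x y : EuclideanSpace ℝ (Fin K)}
    (hx : x ∈ probSimplex K) (hy : y ∈ probSimplex K) : ‖x - y‖ ^ 2 ≤ 2 := by
  obtain ⟨hx, hx0⟩ := hx
  obtain ⟨hy, hy0⟩ := hy
  have hx1 (k : Fin K) : x k ≤ 1 :=
    hx ▸ Finset.single_le_sum (fun i _ => hx0 i) (Finset.mem_univ k)
  have hy1 (k : Fin K) : y k ≤ 1 :=
    hy ▸ Finset.single_le_sum (fun i _ => hy0 i) (Finset.mem_univ k)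
  rw [EuclideanSpace.norm_sq_eq]
  calc ∑ k, ‖(x - y) k‖ ^ 2 ≤ ∑ k, (x k + y k) := by
        refine Finset.sum_le_sum fun k _ => ?_
        rw [Real.norm_eq_abs, sq_abs, PiLp.sub_apply]
        nlinarith [hx0 k, hy0 k, hx1 k, hy1 k, mul_nonneg (hx0 k) (hy0 k)]
    _ = 2 := by rw [Finset.sum_add_distrib, hx, hy]; norm_num

section Projection

variable {E : Type*} [NormedAddCommGroup E] [InnerProductSpace ℝ E]

/-- A nearest point of a convex set is at least as close to each point of the set as the
projected point is. -/
theorem Convex.norm_sub_sq_le_of_isNearest {S : Set E} (hS : Convex ℝ S) {p v x : E}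
    (hp : p ∈ S) (hmin : ∀ w ∈ S, ‖p - v‖ ≤ ‖w - v‖) (hx : x ∈ S) :
    ‖p - x‖ ^ 2 ≤ ‖v - x‖ ^ 2 := by
  have : Nonempty S := ⟨⟨p, hp⟩⟩
  have hinf : ‖v - p‖ = ⨅ w : S, ‖v - w‖ := by
    refine le_antisymm (le_ciInf fun w => ?_)
      (ciInf_le (f := fun w : S => ‖v - w‖) ⟨0, ?_⟩ ⟨p, hp⟩)
    · rw [norm_sub_rev v p, norm_sub_rev v w]
      exact hmin w w.2
    · rintro _ ⟨w, rfl⟩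
      exact norm_nonneg _
  have hinner := (norm_eq_iInf_iff_real_inner_le_zero hS hp).1 hinf x hx
  have hexp : ‖v - x‖ ^ 2 = ‖v - p‖ ^ 2 - 2 * ⟪v - p, x - p⟫ + ‖x - p‖ ^ 2 := by
    rw [← norm_sub_sq_real, sub_sub_sub_cancel_right]
  rw [norm_sub_rev p x]
  nlinarith [sq_nonneg ‖v - p‖]

/-- One step of projected gradient ascent. -/
theorem Convex.inner_le_of_projected_step {S : Set E} (hS : Convex ℝ S) {p y g x : E} {a M : ℝ}
    (ha : 0 < a) (hp : p ∈ S) (hmin : ∀ w ∈ S, ‖p - (y + (1 / a) • g)‖ ≤ ‖w - (y + (1 / a) • g)‖)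
    (hx : x ∈ S) (hg : ‖g‖ ≤ M) :
    ⟪g, x - y⟫ ≤ a / 2 * (‖y - x‖ ^ 2 - ‖p - x‖ ^ 2) + M ^ 2 / (2 * a) := by
  have hnear := hS.norm_sub_sq_le_of_isNearest hp hmin hx
  have hexp : ‖y + (1 / a) • g - x‖ ^ 2
      = ‖y - x‖ ^ 2 - 2 * (1 / a * ⟪g, x - y⟫) + (1 / a) ^ 2 * ‖g‖ ^ 2 := by
    rw [show y + (1 / a) • g - x = (1 / a) • g - (x - y) by abel, norm_sub_sq_real,
      real_inner_smul_left, norm_smul, mul_pow, Real.norm_eq_abs, sq_abs, norm_sub_rev x y]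
    ring
  have hg2 : ‖g‖ ^ 2 ≤ M ^ 2 := pow_le_pow_left₀ (norm_nonneg _) hg 2
  rw [hexp] at hnear
  have hmul := mul_le_mul_of_nonneg_left hnear (by positivity : 0 ≤ a / 2)
  have hM : ‖g‖ ^ 2 / (2 * a) ≤ M ^ 2 / (2 * a) := by gcongr
  have hcancel : a / 2 * (‖y - x‖ ^ 2 - 2 * (1 / a * ⟪g, x - y⟫) + (1 / a) ^ 2 * ‖g‖ ^ 2)
      = a / 2 * ‖y - x‖ ^ 2 - ⟪g, x - y⟫ + ‖g‖ ^ 2 / (2 * a) := by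
    field_simp
  linarith

end Projection

theorem one_div_succ_le_log_succ_sub_log {n : ℕ} (hn : 1 ≤ n) :
    1 / ((n + 1 : ℕ) : ℝ) ≤ Real.log (n + 1 : ℕ) - Real.log n := by
  have hn0 : (0 : ℝ) < n := by exact_mod_cast hn
  have hn1 : (0 : ℝ) < (n + 1 : ℕ) := by positivity
  have h := Real.log_le_sub_one_of_pos (div_pos hn0 hn1)
  rw [Real.log_div hn0.ne' hn1.ne'] at h
  have : (n : ℝ) / (n + 1 : ℕ) - 1 = -(1 / ((n + 1 : ℕ) : ℝ)) := by
    push_cast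
    field_simp
    ring
  linarith

/-- Regret bound for step sizes `1 / (c λ t)`, given the one-step estimates. -/
theorem sum_le_of_scaled_steps {a D : ℕ → ℝ} {c lam M : ℝ} {s : ℕ} (hlam : 0 < lam) (hc : 1 ≤ c)
    (hM : 0 ≤ M) (hD : ∀ t, 1 ≤ t → t ≤ s → D t ≤ 2)
    (ha : ∀ t, 1 ≤ t → t ≤ s →
      a t ≤ c * lam * t / 2 * (D t - D (t + 1)) - lam / 2 * D t + M / c * (1 / t)) :
    ∀ n, 1 ≤ n → n ≤ s → ∑ t ∈ Finset.Icc 1 n, a t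
      ≤ (c - 1) * lam * n - c * lam * n / 2 * D (n + 1) + M / c * (Real.log n + 1) := by
  intro n hn
  have hgap : 0 ≤ (c - 1) * lam := mul_nonneg (by linarith) hlam.le
  induction n, hn using Nat.le_induction with
  | base =>
    intro h1
    have h := ha 1 le_rfl h1
    have hd := mul_le_mul_of_nonneg_left (hD 1 le_rfl h1) hgap
    simp only [Finset.Icc_self, Finset.sum_singleton, Nat.cast_one, Real.log_one] at h ⊢
    linarith
  | succ n hn ih =>
    intro h1
    have h := ha (n + 1) (by omega) h1
    have hd := mul_le_mul_of_nonneg_left (hD (n + 1) (by omega) h1) hgap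
    have hl := mul_le_mul_of_nonneg_left (one_div_succ_le_log_succ_sub_log hn)
      (by positivity : 0 ≤ M / c)
    have hi := ih (by omega)
    rw [Finset.sum_Icc_succ_top (by omega)]
    have hcast : ((n + 1 : ℕ) : ℝ) = n + 1 := by push_cast; rfl
    rw [hcast] at h hl ⊢
    linarith

/-- Regret bound for step sizes `1 / (λ t)` after time `s`, given the one-step estimates. -/
theorem sum_le_of_harmonic_steps {a D : ℕ → ℝ} {lam M A : ℝ} {s T : ℕ} (hM : 0 ≤ M) (hs : 1 ≤ s)
    (hbase : ∑ t ∈ Finset.Icc 1 s, a t ≤ A - lam * s / 2 * D (s + 1))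
    (ha : ∀ t, s < t → t ≤ T →
      a t ≤ lam * t / 2 * (D t - D (t + 1)) - lam / 2 * D t + M * (1 / t)) :
    ∀ n, s ≤ n → n ≤ T → ∑ t ∈ Finset.Icc 1 n, a t
      ≤ A - lam * n / 2 * D (n + 1) + M * (Real.log n - Real.log s) := by
  intro n hn
  induction n, hn using Nat.le_induction with
  | base => intro _; linarith
  | succ n hn ih =>
    intro h1
    have h := ha (n + 1) (by omega) h1
    have hl := mul_le_mul_of_nonneg_left (one_div_succ_le_log_succ_sub_log (hs.trans hn)) hM
    have hi := ih (by omega)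
    rw [Finset.sum_Icc_succ_top (by omega)]
    have hcast : ((n + 1 : ℕ) : ℝ) = n + 1 := by push_cast; rfl
    rw [hcast] at h hl ⊢
    linarith

/-- The algebraic identity behind the choice of the constant `c`. -/
theorem learning_rate_constant_identity {lam mu c L r : ℝ} (hlam : 0 < lam) (hmu : 0 < mu)
    (hr : 0 < r) (hL : 0 < L) (hc : c = mu / lam * Real.sqrt (L / (2 * r))) :
    (mu * Real.sqrt (L / (2 * lam)) - Real.sqrt (r * lam)) ^ 2
      = mu ^ 2 / (2 * lam) * L + r * lam - c * lam * r - mu ^ 2 / (2 * lam) / c * L := by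
  set w := Real.sqrt (L / (2 * r)) with hw
  have hw0 : 0 < w := Real.sqrt_pos.2 (by positivity)
  have hw2 : L = 2 * r * w ^ 2 := by
    rw [hw, Real.sq_sqrt (by positivity)]
    field_simp
  have h1 : Real.sqrt (L / (2 * lam)) * Real.sqrt (r * lam) = r * w := by
    rw [← Real.sqrt_mul (by positivity),
      show L / (2 * lam) * (r * lam) = (r * w) ^ 2 by rw [hw2]; field_simp,
      Real.sqrt_sq (by positivity)]
  have h2 : Real.sqrt (L / (2 * lam)) ^ 2 = L / (2 * lam) := Real.sq_sqrt (by positivity)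
  have h3 : Real.sqrt (r * lam) ^ 2 = r * lam := Real.sq_sqrt (by positivity)
  have hclam : c * lam * r = mu * (r * w) := by
    rw [hc]
    field_simp
  have hdiv : mu ^ 2 / (2 * lam) / c * L = mu * (r * w) := by
    rw [hc, hw2]
    field_simp
  rw [sub_sq, mul_pow, h2, h3, hclam, hdiv,
    show 2 * (mu * Real.sqrt (L / (2 * lam))) * Real.sqrt (r * lam)
      = 2 * mu * (Real.sqrt (L / (2 * lam)) * Real.sqrt (r * lam)) by ring, h1]
  ring

/-- **Theorem 3** (deterministic form): `O(log T / T)` convergence of the adversarial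
distribution with the variance-reducing adaptive learning rate
`η_t = 1/(c λ t)` for `t ≤ s` and `η_t = 1/(λ t)` for `t > s`, where
`c = (μ/λ)√(log s/(2s)) > 1` and `β = (μ√(log s/(2λ)) − √(sλ))²`. -/
theorem adversarial_distribution_convergence
    (K T s : ℕ) (lam mu : ℝ) (hlam : 0 < lam) (hmu : 0 < mu)
    (hs2 : 2 ≤ s) (hsT : s ≤ T)
    (c : ℝ) (hc_def : c = mu / lam * Real.sqrt (Real.log s / (2 * s)))
    (hc : 1 < c)
    (β : ℝ) (hβ : β = (mu * Real.sqrt (Real.log s / (2 * lam)) - Real.sqrt (s * lam)) ^ 2)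
    (f : ℕ → EuclideanSpace ℝ (Fin K) → ℝ)
    (G : ℕ → EuclideanSpace ℝ (Fin K) → EuclideanSpace ℝ (Fin K))
    (q : ℕ → EuclideanSpace ℝ (Fin K))
    (hgrad : ∀ t x, HasGradientAt (f t) (G t x) x)
    (hconc : ∀ t x y, f t y ≤ f t x + ⟪G t x, y - x⟫ - lam / 2 * ‖y - x‖ ^ 2)
    (hq1 : q 1 ∈ probSimplex K)
    (hgbound : ∀ t, 1 ≤ t → t ≤ T → ‖G t (q t)‖ ≤ mu)
    (hproj : ∀ t, 1 ≤ t → t ≤ T →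
      q (t + 1) ∈ probSimplex K ∧
      ∀ p ∈ probSimplex K,
        ‖q (t + 1) - (q t + (if t ≤ s then 1 / (c * lam * t) else 1 / (lam * t)) • G t (q t))‖
          ≤ ‖p - (q t + (if t ≤ s then 1 / (c * lam * t) else 1 / (lam * t)) • G t (q t))‖) :
    ∀ qstar ∈ probSimplex K,
      (1 / T : ℝ) * ∑ t ∈ Finset.Icc 1 T, (f t qstar - f t (q t))
        ≤ (1 / T : ℝ) * (mu ^ 2 / (2 * lam) * (Real.log T + 1) - β) := by
  intro x hx
  have hT : (0 : ℝ) < T := by exact_mod_cast (by omega : 0 < T)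
  have hs : (0 : ℝ) < s := by exact_mod_cast (by omega : 0 < s)
  have hL : 0 < Real.log s := Real.log_pos (by exact_mod_cast (by omega : 1 < s))
  have hc0 : 0 < c := by linarith
  set M := mu ^ 2 / (2 * lam) with hMdef
  have hM : 0 ≤ M := by positivity
  have hmem (t : ℕ) (h1 : 1 ≤ t) (h2 : t ≤ T) : q t ∈ probSimplex K := by
    obtain rfl | h := h1.eq_or_lt
    · exact hq1
    · obtain ⟨m, rfl⟩ : ∃ m, t = m + 1 := ⟨t - 1, by omega⟩
      exact (hproj m (by omega) (by omega)).1
  have hstep (t : ℕ) (h1 : 1 ≤ t) (h2 : t ≤ T) {r : ℝ} (hr : 0 < r)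
      (hrt : (if t ≤ s then 1 / (c * lam * t) else 1 / (lam * t)) = 1 / r) :
      f t x - f t (q t) ≤ r / 2 * (‖q t - x‖ ^ 2 - ‖q (t + 1) - x‖ ^ 2)
        - lam / 2 * ‖q t - x‖ ^ 2 + mu ^ 2 / (2 * r) := by
    obtain ⟨hp, hmin⟩ := hproj t h1 h2
    rw [hrt] at hmin
    have h := (convex_probSimplex K).inner_le_of_projected_step hr hp hmin hx (hgbound t h1 h2)
    have h' := hconc t (q t) x
    rw [norm_sub_rev x] at h'
    linarith
  have hfirst := sum_le_of_scaled_steps (a := fun t => f t x - f t (q t))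
    (D := fun t => ‖q t - x‖ ^ 2) (s := s) hlam hc.le hM
    (fun t h1 h2 => norm_sub_sq_le_two_of_mem_probSimplex (hmem t h1 (h2.trans hsT)) hx)
    (fun t h1 h2 => by
      have ht : (0 : ℝ) < t := by exact_mod_cast h1
      have h := hstep t h1 (h2.trans hsT) (r := c * lam * t) (by positivity) (if_pos h2)
      rwa [show mu ^ 2 / (2 * (c * lam * t)) = M / c * (1 / t) by
        rw [hMdef]; field_simp] at h) s (by omega) le_rfl
  have hsum := sum_le_of_harmonic_steps (a := fun t => f t x - f t (q t))
    (D := fun t => ‖q t - x‖ ^ 2) (lam := lam) (T := T)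
    (A := (c - 1) * lam * s + M / c * (Real.log s + 1)) hM (by omega : 1 ≤ s)
    (by
      have : 0 ≤ (c - 1) * (lam * s / 2 * ‖q (s + 1) - x‖ ^ 2) :=
        mul_nonneg (by linarith) (by positivity)
      linarith)
    (fun t h1 h2 => by
      have ht : (0 : ℝ) < t := by exact_mod_cast (by omega : 0 < t)
      have h := hstep t (by omega) h2 (r := lam * t) (by positivity) (if_neg (by omega))
      rwa [show mu ^ 2 / (2 * (lam * t)) = M * (1 / t) by
        rw [hMdef]; field_simp] at h) T hsT le_rfl
  have hid := learning_rate_constant_identity hlam hmu hs hL hc_def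
  rw [← hβ, ← hMdef] at hid
  have hMc : M / c ≤ M := div_le_self hM hc.le
  have hlast : 0 ≤ lam * T / 2 * ‖q (T + 1) - x‖ ^ 2 := by positivity
  refine mul_le_mul_of_nonneg_left ?_ (by positivity)
  linarith
end
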